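/- arXiv:2201.00626 — 3 statements merged into one kernel-verified Lean document; each statement's English description precedes it below -/
import Mathlib

section
/- Let E be a real inner product space and K ≥ 1 a natural number. Let f, f₁, …, f_K : E → ℝ be differentiable with gradients ∇f, ∇f_k. Fix w ∈ E, stale iterates w'₁, …, w'_K ∈ E, aggregation weights a₁, …, a_K ≥ 0, staleness-drift coefficients b₁, …, b_K ∈ [0,1], a learning rate η ≥ 0, and constants L ≥ 0, φ ≥ 0. Assume: (i) for all x, y ∈ E, f(y) ≤ f(x) + ⟨∇f(x), y − x⟩ + (L/2)‖y − x‖²; (ii) for each k, ⟨∇f_k(w'_k) − ∇f(w'_k), ∇f(w)⟩ = 0 and ⟨∇f_k(w'_k) − ∇f(w'_k), ∇f(w'_k)⟩ = 0; (iii) for each k, ‖∇f_k(w'_k) − ∇f(w'_k)‖² ≤ φ²; (iv) for each k, ‖∇f(w) − ∇f(w'_k)‖² ≤ b_k·‖∇f(w'_k)‖²; (v) for each k, L·η·a_k ≤ K·(1 − b_k). Then, with μ = (1/K)∑_{k=1}^K a_k and M₂ = (1/K)∑_{k=1}^K a_k², one has (1/K)∑_{k=1}^K f(w − (η a_k / K)·∇f_k(w'_k))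 ≤ f(w) − (η μ /(2K))·‖∇f(w)‖² + (L η² M₂ φ²)/(2K²). -/
open RealInnerProductSpace Finset

/-- Theorem 3 of the paper (finite form): one-step convergence rate of the
staleness-aware asynchronous federated learning aggregation. -/
theorem staleness_aware_AFL_one_step {E : Type*} [NormedAddCommGroup E]
    [InnerProductSpace ℝ E]
    (K : ℕ) (hK : 1 ≤ K)
    (f : E → ℝ) (floc : Fin K → E → ℝ)
    (G : E → E) (Gloc : Fin K → E → E)
    (hdifff : ∀ x, HasFDerivAt f (innerSL ℝ (G x)) x)
    (hdiffloc : ∀ k x, HasFDerivAt (floc k) (innerSL ℝ (Gloc k x)) x)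
    (w : E) (w' : Fin K → E) (a : Fin K → ℝ) (b : Fin K → ℝ)
    (η L φ : ℝ)
    (ha : ∀ k, 0 ≤ a k) (hb : ∀ k, b k ∈ Set.Icc (0 : ℝ) 1)
    (hη : 0 ≤ η) (hL : 0 ≤ L) (hφ : 0 ≤ φ)
    (hdescent : ∀ x y, f y ≤ f x + ⟪G x, y - x⟫ + (L / 2) * ‖y - x‖ ^ 2)
    (horth1 : ∀ k, ⟪Gloc k (w' k) - G (w' k), G w⟫ = 0)
    (horth2 : ∀ k, ⟪Gloc k (w' k) - G (w' k), G (w' k)⟫ = 0)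
    (hvar : ∀ k, ‖Gloc k (w' k) - G (w' k)‖ ^ 2 ≤ φ ^ 2)
    (hdrift : ∀ k, ‖G w - G (w' k)‖ ^ 2 ≤ b k * ‖G (w' k)‖ ^ 2)
    (hcond : ∀ k, L * η * a k ≤ K * (1 - b k)) :
    ((1 : ℝ) / K) * ∑ k, f (w - (η * a k / K) • Gloc k (w' k)) ≤
      f w - (η * (((1 : ℝ) / K) * ∑ k, a k) / (2 * K)) * ‖G w‖ ^ 2
        + (L * η ^ 2 * (((1 : ℝ) / K) * ∑ k, (a k) ^ 2) * φ ^ 2) / (2 * K ^ 2) := by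
  have hKpos : (0 : ℝ) < K := by exact_mod_cast hK
  have key : ∀ k, f (w - (η * a k / K) • Gloc k (w' k)) ≤
      f w - (η * a k / K) / 2 * ‖G w‖ ^ 2 + L / 2 * (η * a k / K) ^ 2 * φ ^ 2 := by
    intro k
    have ht : 0 ≤ η * a k / K := div_nonneg (mul_nonneg hη (ha k)) hKpos.le
    have hLt : L * (η * a k / K) ≤ 1 - b k := by
      rw [← mul_div_assoc, div_le_iff₀ hKpos]
      linarith [hcond k]
    generalize η * a k / K = t at ht hLt ⊢
    have h0 := hdescent w (w - t • Gloc k (w' k))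
    obtain ⟨d, hd⟩ : ∃ d, d = Gloc k (w' k) - G (w' k) := ⟨_, rfl⟩
    have hg : Gloc k (w' k) = G (w' k) + d := by rw [hd]; abel
    have h1 := horth1 k
    have h2 := horth2 k
    have h3 := hvar k
    have h4 := hdrift k
    rw [← hd] at h1 h2 h3
    have e1 : w - t • Gloc k (w' k) - w = -(t • Gloc k (w' k)) := by abel
    rw [e1, norm_neg, norm_smul, mul_pow, Real.norm_eq_abs, sq_abs, inner_neg_right,
      inner_smul_right, hg, inner_add_right, real_inner_comm d (G w), norm_add_sq_real,
      real_inner_comm d (G (w' k))] at h0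
    rw [hg]
    rw [norm_sub_sq_real] at h4
    rw [real_inner_comm] at h1 h2
    simp only [real_inner_comm] at h0 h1 h2 h4
    have h5 : 0 ≤ t * (1 - b k - L * t) * ‖G (w' k)‖ ^ 2 :=
      mul_nonneg (mul_nonneg ht (by linarith)) (sq_nonneg _)
    have h6 := mul_le_mul_of_nonneg_left h4 ht
    have h7 := mul_le_mul_of_nonneg_left h3 (mul_nonneg hL (sq_nonneg t))
    simp only [h1, h2] at h0
    nlinarith
  have hs := Finset.sum_le_sum (fun k (_ : k ∈ Finset.univ) => key k)
  have hs2 := mul_le_mul_of_nonneg_left hs (by positivity : (0 : ℝ) ≤ 1 / K)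
  refine hs2.trans (le_of_eq ?_)
  have e1 : ∀ k, f w - (η * a k / K) / 2 * ‖G w‖ ^ 2 + L / 2 * (η * a k / K) ^ 2 * φ ^ 2 =
      f w - a k * (η / K / 2 * ‖G w‖ ^ 2) + a k ^ 2 * (L / 2 * (η / K) ^ 2 * φ ^ 2) := by
    intro k; ring
  simp only [e1]
  rw [Finset.sum_add_distrib, Finset.sum_sub_distrib, ← Finset.sum_mul, ← Finset.sum_mul]
  simp only [Finset.sum_const, Finset.card_univ, Fintype.card_fin, nsmul_eq_mul]
  field_simp
end

section
/- Let E be a real inner product space and K ≥ 1 a natural number. Let f, f₁, …, f_K : E → ℝ be differentiable with gradients ∇f, ∇f_k. Fix w ∈ E, stale iterates w'₁, …, w'_K ∈ E, coefficients b₁, …, b_K ∈ [0,1], a learning rate η ≥ 0, and constants L ≥ 0, φ ≥ 0. Assume: (i) for all x, y ∈ E, f(y) ≤ f(x) + ⟨∇f(x), y − x⟩ + (L/2)‖y − x‖²; (ii) for each k, ⟨∇f_k(w'_k) − ∇f(w'_k), ∇f(w)⟩ = 0 and ⟨∇f_k(w'_k) − ∇f(w'_k), ∇f(w'_k)⟩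 = 0; (iii) for each k, ‖∇f_k(w'_k) − ∇f(w'_k)‖² ≤ φ²; (iv) for each k, ‖∇f(w) − ∇f(w'_k)‖² ≤ b_k·‖∇f(w'_k)‖²; (v) for each k, L·η ≤ K·(1 − b_k). Then (1/K)∑_{k=1}^K f(w − (η/K)·∇f_k(w'_k)) ≤ f(w) − (η/(2K))·‖∇f(w)‖² + (L η² φ²)/(2K²). -/
open RealInnerProductSpace Finset

/-- Corollary 2 of the paper: one-step convergence rate of asynchronous
federated learning with staleness-free aggregation (weights `g₁(δ) = 1`). -/
theorem staleness_free_AFL_one_step {E : Type*} [NormedAddCommGroup E]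
    [InnerProductSpace ℝ E]
    (K : ℕ) (hK : 1 ≤ K)
    (f : E → ℝ) (floc : Fin K → E → ℝ)
    (G : E → E) (Gloc : Fin K → E → E)
    (hdifff : ∀ x, HasFDerivAt f (innerSL ℝ (G x)) x)
    (hdiffloc : ∀ k x, HasFDerivAt (floc k) (innerSL ℝ (Gloc k x)) x)
    (w : E) (w' : Fin K → E) (b : Fin K → ℝ)
    (η L φ : ℝ)
    (hb : ∀ k, b k ∈ Set.Icc (0 : ℝ) 1)
    (hη : 0 ≤ η) (hL : 0 ≤ L) (hφ : 0 ≤ φ)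
    (hdescent : ∀ x y, f y ≤ f x + ⟪G x, y - x⟫ + (L / 2) * ‖y - x‖ ^ 2)
    (horth1 : ∀ k, ⟪Gloc k (w' k) - G (w' k), G w⟫ = 0)
    (horth2 : ∀ k, ⟪Gloc k (w' k) - G (w' k), G (w' k)⟫ = 0)
    (hvar : ∀ k, ‖Gloc k (w' k) - G (w' k)‖ ^ 2 ≤ φ ^ 2)
    (hdrift : ∀ k, ‖G w - G (w' k)‖ ^ 2 ≤ b k * ‖G (w' k)‖ ^ 2)
    (hcond : ∀ k, L * η ≤ K * (1 - b k)) :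
    ((1 : ℝ) / K) * ∑ k, f (w - (η / K) • Gloc k (w' k)) ≤
      f w - (η / (2 * K)) * ‖G w‖ ^ 2 + (L * η ^ 2 * φ ^ 2) / (2 * K ^ 2) := by
  have hK0 : (0 : ℝ) < K := by exact_mod_cast hK
  have key : ∀ k, f (w - (η / K) • Gloc k (w' k)) ≤
      f w - (η / (2 * K)) * ‖G w‖ ^ 2 + (L * η ^ 2 * φ ^ 2) / (2 * K ^ 2) := by
    intro k
    obtain ⟨t, ht⟩ : ∃ t : ℝ, t = η / K := ⟨_, rfl⟩
    have ht0 : 0 ≤ t := by rw [ht]; positivity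
    have e1 : η / (2 * K) = t / 2 := by rw [ht]; field_simp
    have e2 : (L * η ^ 2 * φ ^ 2) / (2 * K ^ 2) = L * t ^ 2 * φ ^ 2 / 2 := by
      rw [ht]; field_simp
    have hLt : L * t ≤ 1 - b k := by
      rw [ht, ← mul_div_assoc, div_le_iff₀ hK0]
      linarith [hcond k]
    rw [e1, e2, ← ht]
    have hd := hdescent w (w - t • Gloc k (w' k))
    have h1 := horth1 k
    have h2 := horth2 k
    have h3 := hvar k
    have h4 := hdrift k
    obtain ⟨e, he⟩ : ∃ e, e = Gloc k (w' k) - G (w' k) := ⟨_, rfl⟩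
    have hg : Gloc k (w' k) = e + G (w' k) := by rw [he]; abel
    rw [← he] at h1 h2 h3
    have s1 : w - t • Gloc k (w' k) - w = -(t • Gloc k (w' k)) := by abel
    rw [s1, norm_neg, norm_smul, mul_pow, inner_neg_right, inner_smul_right, hg,
      inner_add_right, real_inner_comm, h1, norm_add_sq_real, h2, Real.norm_eq_abs,
      sq_abs, ← hg] at hd
    rw [norm_sub_sq_real] at h4
    have m1 := mul_le_mul_of_nonneg_left h4 ht0
    have m2 := mul_le_mul_of_nonneg_left h3 (mul_nonneg hL (sq_nonneg t))
    have m3 := mul_le_mul_of_nonneg_right hLt (mul_nonneg ht0 (sq_nonneg ‖G (w' k)‖))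
    nlinarith
  have hs := Finset.sum_le_sum (fun k (_ : k ∈ (Finset.univ : Finset (Fin K))) => key k)
  rw [Finset.sum_const, Finset.card_univ, Fintype.card_fin, nsmul_eq_mul] at hs
  rw [one_div, inv_mul_le_iff₀ hK0]
  exact hs
end

section
/- Let x₁, x₂, r, θ, R be real numbers with |x₁·cos θ + x₂·sin θ + r| ≤ R, and set d = |x₁·cos θ + x₂·sin θ + r|. Then the Lebesgue measure of the set {t ∈ ℝ : (x₁ + r·cos θ + t·sin θ)² + (x₂ + r·sin θ − t·cos θ)² ≤ R²} equals 2·√(R² − d²). -/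
open MeasureTheory

/-- Lemma 3 of the paper (chord length of a corridor): the portion of the
corridor `t ↦ (x₁ + r cos θ + t sin θ, x₂ + r sin θ − t cos θ)` lying inside
the disc of radius `R` centered at the origin has length `2√(R² − d²)`, where
`d = |x₁ cos θ + x₂ sin θ + r|` is the distance from the origin to the
corridor. -/
theorem corridor_chord_length (x₁ x₂ r θ R : ℝ)
    (h : |x₁ * Real.cos θ + x₂ * Real.sin θ + r| ≤ R)
    (d : ℝ) (hd : d = |x₁ * Real.cos θ + x₂ * Real.sin θ + r|) :
    volume {t : ℝ |
        (x₁ + r * Real.cos θ + t * Real.sin θ) ^ 2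
          + (x₂ + r * Real.sin θ - t * Real.cos θ) ^ 2 ≤ R ^ 2}
      = ENNReal.ofReal (2 * Real.sqrt (R ^ 2 - d ^ 2)) := by
  have hd2 : d ^ 2 = (x₁ * Real.cos θ + x₂ * Real.sin θ + r) ^ 2 := by
    rw [hd, sq_abs]
  have h0 : 0 ≤ R ^ 2 - d ^ 2 := by
    have h1 : 0 ≤ d := hd ▸ abs_nonneg _
    have h2 : d ≤ R := hd ▸ h
    nlinarith
  have hcs := Real.sin_sq_add_cos_sq θ
  have key : ∀ t : ℝ, (x₁ + r * Real.cos θ + t * Real.sin θ) ^ 2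
          + (x₂ + r * Real.sin θ - t * Real.cos θ) ^ 2
        = (t + (x₁ * Real.sin θ - x₂ * Real.cos θ)) ^ 2 + d ^ 2 := by
    intro t
    rw [hd2]
    linear_combination (r ^ 2 + t ^ 2 - x₁ ^ 2 - x₂ ^ 2) * hcs
  have hset : {t : ℝ |
        (x₁ + r * Real.cos θ + t * Real.sin θ) ^ 2
          + (x₂ + r * Real.sin θ - t * Real.cos θ) ^ 2 ≤ R ^ 2}
      = Set.Icc (-(x₁ * Real.sin θ - x₂ * Real.cos θ) - Real.sqrt (R ^ 2 - d ^ 2))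
          (-(x₁ * Real.sin θ - x₂ * Real.cos θ) + Real.sqrt (R ^ 2 - d ^ 2)) := by
    ext t
    rw [Set.mem_setOf_eq, key, ← le_sub_iff_add_le, Real.sq_le h0, Set.mem_Icc]
    constructor <;> rintro ⟨h1, h2⟩ <;> constructor <;> linarith
  rw [hset, Real.volume_Icc]
  congr 1
  ring
end
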